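/- For all integers k ≥ 0 and ℓ_1,…,ℓ_k ≥ 1, the Grundy value of the 0.33 game on the subdivided star S_{ℓ_1,…,ℓ_k} equals the Grundy value of the 0.33 game on the subdivided star S_{ℓ_1 mod 3,…,ℓ_k mod 3}, where arms whose length is congruent to 0 modulo 3 are omitted from the latter star. -/

import Mathlib

open SimpleGraph

/-- The minimum excludant of a set of naturals. -/
noncomputable def mex (A : Set ℕ) : ℕ := sInf {n : ℕ | n ∉ A}

/-- The connected component (as a vertex set) of `x` in the subgraph of `G`
induced on the vertex set `s`. -/
def compOf {V : Type} (G : SimpleGraph V) (s : Set V) (x : V) : Set V :=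
  {v | ∃ (hx : x ∈ s) (hv : v ∈ s), (G.induce s).Reachable ⟨x, hx⟩ ⟨v, hv⟩}

/-- A legal move of the 0.33 game on the graph `G`, from the position (vertex set) `s`
to the position `t`: one removes either a single vertex of `s`, or two vertices of `s`
that are adjacent in `G`, and the removed set may not disconnect the connected component
`H` (of the subgraph induced on `s`) containing it: `H` minus the removed set must be
connected or empty. -/
def ValidMove {V : Type} [DecidableEq V] (G : SimpleGraph V) (s t : Finset V) : Prop :=
  t ⊆ s ∧
  ((∃ x ∈ s, s \ t = {x}) ∨ (∃ x ∈ s, ∃ y ∈ s, G.Adj x y ∧ s \ t = {x, y})) ∧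
  ∀ x ∈ s \ t,
    (compOf G (↑s) x \ (↑(s \ t) : Set V) = ∅ ∨
     (G.induce (compOf G (↑s) x \ (↑(s \ t) : Set V))).Connected)

theorem ValidMove.card_lt {V : Type} [DecidableEq V] {G : SimpleGraph V} {s t : Finset V}
    (h : ValidMove G s t) : t.card < s.card := by
  apply Finset.card_lt_card
  rw [Finset.ssubset_iff_of_subset h.1]
  rcases h.2.1 with ⟨x, hx, he⟩ | ⟨x, hx, y, hy, _, he⟩
  · refine ⟨x, hx, fun hxt => ?_⟩
    have hmem : x ∈ s \ t := by rw [he]; exact Finset.mem_singleton_self x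
    exact (Finset.mem_sdiff.mp hmem).2 hxt
  · refine ⟨x, hx, fun hxt => ?_⟩
    have hmem : x ∈ s \ t := by rw [he]; simp
    exact (Finset.mem_sdiff.mp hmem).2 hxt

/-- The Grundy value of the 0.33 game on the graph `G` played on the vertex set `s`. -/
noncomputable def grundy {V : Type} [DecidableEq V] (G : SimpleGraph V) (s : Finset V) : ℕ :=
  mex {n : ℕ | ∃ t : {t : Finset V // ValidMove G s t}, grundy G t.1 = n}
termination_by s.card
decreasing_by exact t.2.card_lt

/-! ### Concrete graphs

`pathG` played on `Finset.range n` is the path `P_n`;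
`cycleG n` played on `Finset.range n` is the cycle `C_n`.

Subdivided stars and bistars are encoded on vertex type `ℕ × ℕ`.
A subdivided star is given by the list `L` of the numbers of vertices of its arms
(`some L`), or is the empty graph (`none`).
In the bistar `S₁ •m• S₂`, the center of `S₁` is `(0,0)`, the middle path consists of
`(1,1), …, (1,m)` where `(1,m)` is the center of `S₂` (when `m = 0` the two centers are
identified to `(0,0)`), the `i`-th arm of `S₁` consists of `(2i+2, 1), …, (2i+2, ℓᵢ)`,
and the `i`-th arm of `S₂` consists of `(2i+3, 1), …, (2i+3, ℓ'ᵢ)`.  If `S₂` is the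
empty graph, its center `(1,m)` is removed (so `S₁` just gets an extra arm with `m-1`
vertices), and similarly for `S₁`. -/

def pathG : SimpleGraph ℕ := SimpleGraph.fromRel (fun u v => v = u + 1)

def cycleG (n : ℕ) : SimpleGraph ℕ := SimpleGraph.fromRel (fun u v => v % n = (u + 1) % n)

def bistarG (m : ℕ) : SimpleGraph (ℕ × ℕ) :=
  SimpleGraph.fromRel (fun u v =>
    (u = (0, 0) ∧ v = (1, 1)) ∨
    (u.1 = 1 ∧ v.1 = 1 ∧ v.2 = u.2 + 1) ∨
    (u = (0, 0) ∧ 2 ≤ v.1 ∧ v.1 % 2 = 0 ∧ v.2 = 1) ∨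
    (u = (if m = 0 then ((0 : ℕ), (0 : ℕ)) else (1, m)) ∧ 3 ≤ v.1 ∧ v.1 % 2 = 1 ∧ v.2 = 1) ∨
    (u.1 = v.1 ∧ 2 ≤ u.1 ∧ v.2 = u.2 + 1))

def armVerts (base : ℕ) (L : List ℕ) : Finset (ℕ × ℕ) :=
  (Finset.range L.length).biUnion
    (fun i => (Finset.range (L.getD i 0)).image (fun j => (2 * i + base, j + 1)))

def bistarVerts (S1 S2 : Option (List ℕ)) (m : ℕ) : Finset (ℕ × ℕ) :=
  (match S1 with
   | none => (∅ : Finset (ℕ × ℕ))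
   | some L => insert ((0 : ℕ), (0 : ℕ)) (armVerts 2 L)) ∪
  (match S2 with
   | none => (Finset.range (m - 1)).image (fun p => ((1 : ℕ), p + 1))
   | some L => ((Finset.range m).image (fun p => ((1 : ℕ), p + 1))) ∪ armVerts 3 L)

/-- Grundy value of the 0.33 game on the subdivided bistar `S₁ •m• S₂`
(where `S₁`, `S₂` are subdivided stars or the empty graph). -/
noncomputable def bistarGrundyO (S1 S2 : Option (List ℕ)) (m : ℕ) : ℕ :=
  grundy (bistarG m) (bistarVerts S1 S2 m)

/-- Grundy value of the 0.33 game on the subdivided bistar `S_{L₁} •m• S_{L₂}`. -/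
noncomputable def bistarGrundy (L1 L2 : List ℕ) (m : ℕ) : ℕ :=
  bistarGrundyO (some L1) (some L2) m

/-- Grundy value of the 0.33 game on the subdivided star `S_L`. -/
noncomputable def starGrundy (L : List ℕ) : ℕ := bistarGrundy L [] 0

/-- Grundy value of the 0.33 game on a subdivided star or the empty graph. -/
noncomputable def starGrundyO (S : Option (List ℕ)) : ℕ := bistarGrundyO S (some []) 0

/-- Every arm of the subdivided star has at least one vertex. -/
def armsPos (L : List ℕ) : Prop := ∀ ℓ ∈ L, 1 ≤ ℓ

section Grundy

variable {V : Type} {G : SimpleGraph V}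

/-- In a connected vertex set, a nonempty part closed under adjacency is everything. -/
theorem mem_of_preconnected_of_closed {S A : Set V} (hS : (G.induce S).Preconnected) {x y : V}
    (hx : x ∈ S) (hxA : x ∈ A) (hy : y ∈ S)
    (hA : ∀ u ∈ S, u ∈ A → ∀ v ∈ S, G.Adj u v → v ∈ A) : y ∈ A := by
  obtain ⟨w⟩ := hS ⟨x, hx⟩ ⟨y, hy⟩
  have key : ∀ (u v : S), (G.induce S).Walk u v → (u : V) ∈ A → (v : V) ∈ A := by
    intro u v w
    induction w with
    | nil => exact id
    | cons h _ ih => exact fun hu => ih (hA _ (Subtype.prop _) hu _ (Subtype.prop _) h)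
  exact key _ _ w hxA

/-- A vertex set in which one can always walk down towards a root is connected. -/
theorem preconnected_of_rank {S : Set V} (r : V) (rank : V → ℕ)
    (h : ∀ x ∈ S, x = r ∨ ∃ y ∈ S, G.Adj x y ∧ rank y < rank x) :
    (G.induce S).Preconnected := by
  have key : ∀ n, ∀ x (hx : x ∈ S), rank x = n →
      ∃ hr : r ∈ S, (G.induce S).Reachable ⟨x, hx⟩ ⟨r, hr⟩ := by
    intro n
    induction n using Nat.strong_induction_on with
    | _ n ih =>
      rintro x hx rfl
      rcases h x hx with rfl | ⟨y, hy, hxy, hlt⟩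
      · exact ⟨hx, Reachable.refl _⟩
      · obtain ⟨hr, hyr⟩ := ih _ hlt y hy rfl
        have hadj : (G.induce S).Adj ⟨x, hx⟩ ⟨y, hy⟩ := hxy
        exact ⟨hr, hadj.reachable.trans hyr⟩
  rintro ⟨x, hx⟩ ⟨y, hy⟩
  obtain ⟨_, h₁⟩ := key _ x hx rfl
  obtain ⟨_, h₂⟩ := key _ y hy rfl
  exact h₁.trans h₂.symm

/-- `f 0, …, f (n - 1)` are distinct and span an induced path of `G`. -/
def IsInducedPath (G : SimpleGraph V) (f : ℕ → V) (n : ℕ) : Prop :=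
  ∀ i < n, ∀ j < n, (G.Adj (f i) (f j) ↔ i + 1 = j ∨ j + 1 = i) ∧ (f i = f j → i = j)

theorem IsInducedPath.of_le {f : ℕ → V} {m n : ℕ} (h : IsInducedPath G f n) (hm : m ≤ n) :
    IsInducedPath G f m :=
  fun i hi j hj => h i (by omega) j (by omega)

theorem IsInducedPath.shift {f : ℕ → V} {n d : ℕ} (h : IsInducedPath G f n) :
    IsInducedPath G (fun k => f (k + d)) (n - d) := by
  intro i hi j hj
  have := h (i + d) (by omega) (j + d) (by omega)
  refine ⟨this.1.trans (by omega), fun he => ?_⟩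
  have := this.2 he
  omega

variable [DecidableEq V] {s t : Finset V}

theorem exists_not_mem_options (G : SimpleGraph V) (s : Finset V) :
    {n : ℕ | n ∉ {n : ℕ | ∃ t : {t : Finset V // ValidMove G s t}, grundy G t.1 = n}}.Nonempty := by
  have hfin : {n : ℕ | ∃ t : {t : Finset V // ValidMove G s t}, grundy G t.1 = n}.Finite := by
    refine (s.powerset.image (grundy G)).finite_toSet.subset ?_
    rintro n ⟨t, rfl⟩
    exact Finset.mem_coe.2 (Finset.mem_image_of_mem _ (Finset.mem_powerset.2 t.2.1))
  exact hfin.infinite_compl.nonempty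

theorem ValidMove.grundy_ne (h : ValidMove G s t) : grundy G t ≠ grundy G s := by
  have hmem := Nat.sInf_mem (exists_not_mem_options G s)
  intro heq
  rw [grundy.eq_1 G s] at heq
  exact hmem ⟨⟨t, h⟩, heq⟩

theorem exists_validMove_of_lt_grundy {m : ℕ} (h : m < grundy G s) :
    ∃ t, ValidMove G s t ∧ grundy G t = m := by
  rw [grundy.eq_1 G s] at h
  have := Nat.notMem_of_lt_sInf h
  simp only [Set.mem_ofPred_eq, not_not] at this
  obtain ⟨t, ht⟩ := this
  exact ⟨t.1, t.2, ht⟩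

theorem grundy_eq_of_options {n : ℕ} (hne : ∀ t, ValidMove G s t → grundy G t ≠ n)
    (hlt : ∀ m < n, ∃ t, ValidMove G s t ∧ grundy G t = m) : grundy G s = n := by
  rcases lt_trichotomy (grundy G s) n with h | h | h
  · obtain ⟨t, ht, he⟩ := hlt _ h
    exact absurd he ht.grundy_ne
  · exact h
  · obtain ⟨t, ht, he⟩ := exists_validMove_of_lt_grundy h
    exact absurd he (hne t ht)

/-- On a connected position, a move is legal when it leaves a connected or empty position. -/
theorem validMove_iff_of_preconnected (hs : (G.induce (s : Set V)).Preconnected) :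
    ValidMove G s t ↔ t ⊆ s ∧
      ((∃ x ∈ s, s \ t = {x}) ∨ (∃ x ∈ s, ∃ y ∈ s, G.Adj x y ∧ s \ t = {x, y})) ∧
      (G.induce (t : Set V)).Preconnected := by
  refine and_congr_right fun hts => and_congr_right fun hrem => ?_
  have hcomp : ∀ x ∈ s \ t, compOf G (s : Set V) x \ ((s \ t : Finset V) : Set V) = t := by
    intro x hx
    have hxs : x ∈ (s : Set V) := (Finset.mem_sdiff.1 hx).1
    ext v
    simp only [compOf, Set.mem_sdiff, Set.mem_ofPred_eq, Finset.coe_sdiff, Finset.mem_coe, not_and,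
      not_not]
    exact ⟨fun ⟨⟨_, hv, _⟩, h⟩ => h hv, fun hv => ⟨⟨hxs, hts hv, hs _ _⟩, fun _ => hv⟩⟩
  have hne : (s \ t).Nonempty := by
    rcases hrem with ⟨x, _, h⟩ | ⟨x, _, y, _, _, h⟩ <;> rw [h] <;> simp
  constructor
  · intro h
    obtain ⟨x, hx⟩ := hne
    have hx' := h x hx
    rw [hcomp x hx] at hx'
    rcases hx' with h0 | hc
    · rintro ⟨u, hu⟩
      rw [h0] at hu
      exact hu.elim
    · exact hc.preconnected
  · intro h x hx
    rw [hcomp x hx]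
    rcases Set.eq_empty_or_nonempty (t : Set V) with h0 | h0
    · exact Or.inl h0
    · have := h0.to_subtype
      exact Or.inr ⟨h⟩

theorem IsInducedPath.preconnected {f : ℕ → V} {n : ℕ} (h : IsInducedPath G f n) :
    (G.induce (((Finset.range n).image f : Finset V) : Set V)).Preconnected := by
  have key : ∀ i (hi : i < n), ∃ (h0 : f 0 ∈ (((Finset.range n).image f : Finset V) : Set V))
      (h1 : f i ∈ (((Finset.range n).image f : Finset V) : Set V)),
      (G.induce (((Finset.range n).image f : Finset V) : Set V)).Reachable
        ⟨f i, h1⟩ ⟨f 0, h0⟩ := by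
    have hmem : ∀ i < n, f i ∈ (((Finset.range n).image f : Finset V) : Set V) := fun i hi =>
      Finset.mem_coe.2 (Finset.mem_image_of_mem f (Finset.mem_range.2 hi))
    intro i hi
    induction i with
    | zero => exact ⟨hmem _ hi, hmem _ hi, Reachable.refl _⟩
    | succ i ih =>
      obtain ⟨h0, h1, hr⟩ := ih (by omega)
      refine ⟨h0, hmem _ hi, Reachable.trans (Adj.reachable ?_) hr⟩
      exact (h (i + 1) hi i (by omega)).1.2 (Or.inr rfl)
  rintro ⟨x, hx⟩ ⟨y, hy⟩
  obtain ⟨i, hi, rfl⟩ := Finset.mem_image.1 (Finset.mem_coe.1 hx)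
  obtain ⟨j, hj, rfl⟩ := Finset.mem_image.1 (Finset.mem_coe.1 hy)
  obtain ⟨_, _, h₁⟩ := key i (Finset.mem_range.1 hi)
  obtain ⟨_, _, h₂⟩ := key j (Finset.mem_range.1 hj)
  exact h₁.trans h₂.symm

theorem IsInducedPath.validMove {f : ℕ → V} {n d : ℕ} (h : IsInducedPath G f n)
    (hd : d = 1 ∨ d = 2) (hdn : d ≤ n) :
    ValidMove G ((Finset.range n).image f) ((Finset.range (n - d)).image f) := by
  have hmem : ∀ k < n, ∀ m ≤ n, f k ∈ (Finset.range m).image f ↔ k < m := by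
    intro k hk m hm
    simp only [Finset.mem_image, Finset.mem_range]
    exact ⟨fun ⟨j, hj, he⟩ => (h j (by omega) k hk).2 he ▸ hj, fun hkm => ⟨k, hkm, rfl⟩⟩
  have hsdiff : ∀ v, v ∈ (Finset.range n).image f \ (Finset.range (n - d)).image f ↔
      ∃ k, n - d ≤ k ∧ k < n ∧ v = f k := by
    intro v
    rw [Finset.mem_sdiff]
    constructor
    · rintro ⟨hv, hv'⟩
      obtain ⟨k, hk, rfl⟩ := Finset.mem_image.1 hv
      have hk := Finset.mem_range.1 hk
      rw [hmem k hk _ (by omega)] at hv'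
      exact ⟨k, by omega, hk, rfl⟩
    · rintro ⟨k, hk, hk', rfl⟩
      rw [hmem k hk' _ le_rfl, hmem k hk' _ (by omega)]
      omega
  rw [validMove_iff_of_preconnected h.preconnected]
  refine ⟨Finset.image_subset_image (Finset.range_mono (by omega)), ?_,
    (h.of_le (Nat.sub_le n d)).preconnected⟩
  rcases hd with rfl | rfl
  · refine Or.inl ⟨f (n - 1), (hmem _ (by omega) _ le_rfl).2 (by omega), ?_⟩
    ext v
    rw [hsdiff, Finset.mem_singleton]
    constructor
    · rintro ⟨k, hk, hk', rfl⟩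
      rw [show k = n - 1 by omega]
    · exact fun hv => ⟨n - 1, le_rfl, by omega, hv⟩
  · refine Or.inr ⟨f (n - 2), (hmem _ (by omega) _ le_rfl).2 (by omega),
      f (n - 1), (hmem _ (by omega) _ le_rfl).2 (by omega),
      (h (n - 2) (by omega) (n - 1) (by omega)).1.2 (by omega), ?_⟩
    ext v
    rw [hsdiff, Finset.mem_insert, Finset.mem_singleton]
    constructor
    · rintro ⟨k, hk, hk', rfl⟩
      rcases (by omega : k = n - 2 ∨ k = n - 1) with rfl | rfl
      · exact Or.inl rfl
      · exact Or.inr rfl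
    · rintro (hv | hv)
      · exact ⟨n - 2, le_rfl, by omega, hv⟩
      · exact ⟨n - 1, by omega, by omega, hv⟩

/-- A legal move on an induced path trims one of its two ends. -/
theorem IsInducedPath.eq_of_validMove {f : ℕ → V} {n : ℕ} (h : IsInducedPath G f n)
    (ht : ValidMove G ((Finset.range n).image f) t) :
    ∃ d, (d = 1 ∨ d = 2) ∧ d ≤ n ∧ (t = (Finset.range (n - d)).image f ∨
      t = (Finset.range (n - d)).image (fun k => f (k + d))) := by
  rw [validMove_iff_of_preconnected h.preconnected] at ht
  obtain ⟨hts, hrem, hconn⟩ := ht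
  have hmem : ∀ k < n, f k ∈ (Finset.range n).image f := fun k hk =>
    Finset.mem_image_of_mem f (Finset.mem_range.2 hk)
  obtain ⟨i, d, hd, hid, hk⟩ : ∃ i d, (d = 1 ∨ d = 2) ∧ i + d ≤ n ∧
      ∀ k < n, (f k ∈ t ↔ ¬ (i ≤ k ∧ k < i + d)) := by
    have hnot : ∀ k < n, (f k ∈ t ↔ ¬ f k ∈ (Finset.range n).image f \ t) := by
      intro k hk
      simp [hmem k hk, -Finset.mem_image]
    rcases hrem with ⟨x, hx, he⟩ | ⟨x, hx, y, hy, hxy, he⟩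
    · obtain ⟨i, hi, rfl⟩ := Finset.mem_image.1 hx
      have hi := Finset.mem_range.1 hi
      refine ⟨i, 1, Or.inl rfl, hi, fun k hk => ?_⟩
      rw [hnot k hk, he, Finset.mem_singleton, not_iff_not]
      exact ⟨fun e => by have := (h k hk i hi).2 e; omega,
        fun e => by rw [show k = i by omega]⟩
    · obtain ⟨i, hi, rfl⟩ := Finset.mem_image.1 hx
      obtain ⟨j, hj, rfl⟩ := Finset.mem_image.1 hy
      have hi := Finset.mem_range.1 hi
      have hj := Finset.mem_range.1 hj
      have hij := (h i hi j hj).1.1 hxy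
      refine ⟨min i j, 2, Or.inr rfl, by omega, fun k hk => ?_⟩
      rw [hnot k hk, he, Finset.mem_insert, Finset.mem_singleton, not_iff_not]
      constructor
      · rintro (e | e)
        · have := (h k hk i hi).2 e
          omega
        · have := (h k hk j hj).2 e
          omega
      · intro e
        rcases (by omega : k = i ∨ k = j) with rfl | rfl
        · exact Or.inl rfl
        · exact Or.inr rfl
  have hend : i = 0 ∨ i + d = n := by
    by_contra! hcon
    have h0 : f 0 ∈ t := (hk 0 (by omega)).2 (by omega)
    have h1 : f (n - 1) ∈ t := (hk (n - 1) (by omega)).2 (by omega)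
    have hlast := mem_of_preconnected_of_closed (A := {v | ∃ k < i, v = f k}) hconn
      (Finset.mem_coe.2 h0) ⟨0, by omega, rfl⟩ (Finset.mem_coe.2 h1) (by
        rintro _ - ⟨k, hki, rfl⟩ v hv huv
        obtain ⟨l, hl, rfl⟩ := Finset.mem_image.1 (hts hv)
        have hl := Finset.mem_range.1 hl
        have hkl := (h k (by omega) l hl).1.1 huv
        have := (hk l hl).1 hv
        exact ⟨l, by omega, rfl⟩)
    obtain ⟨k, hki, he⟩ := hlast
    have := (h (n - 1) (by omega) k (by omega)).2 he
    omega
  refine ⟨d, hd, by omega, ?_⟩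
  rcases hend with rfl | hend
  · right
    ext v
    simp only [Finset.mem_image, Finset.mem_range]
    constructor
    · intro hv
      obtain ⟨k, hkn, rfl⟩ := Finset.mem_image.1 (hts hv)
      have hkn := Finset.mem_range.1 hkn
      have := (hk k hkn).1 hv
      exact ⟨k - d, by omega, by rw [Nat.sub_add_cancel (by omega)]⟩
    · rintro ⟨k, hkn, rfl⟩
      exact (hk _ (by omega)).2 (by omega)
  · left
    ext v
    simp only [Finset.mem_image, Finset.mem_range]
    constructor
    · intro hv
      obtain ⟨k, hkn, rfl⟩ := Finset.mem_image.1 (hts hv)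
      have hkn := Finset.mem_range.1 hkn
      have := (hk k hkn).1 hv
      exact ⟨k, by omega, rfl⟩
    · rintro ⟨k, hkn, rfl⟩
      exact (hk _ (by omega)).2 (by omega)

theorem IsInducedPath.grundy_eq {f : ℕ → V} {n : ℕ} (h : IsInducedPath G f n) :
    grundy G ((Finset.range n).image f) = n % 3 := by
  induction n using Nat.strong_induction_on generalizing f with
  | _ n ih =>
    refine grundy_eq_of_options (fun t ht => ?_) (fun m hm => ?_)
    · obtain ⟨d, hd, hdn, rfl | rfl⟩ := h.eq_of_validMove ht
      · rw [ih (n - d) (by omega) (h.of_le (Nat.sub_le n d))]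
        omega
      · rw [ih (n - d) (by omega) h.shift]
        omega
    · refine ⟨_, h.validMove (d := n % 3 - m) (by omega) (by omega), ?_⟩
      rw [ih _ (by omega) (h.of_le (Nat.sub_le _ _))]
      omega

end Grundy

/-- The vertices of the subdivided star whose `i`-th arm has `a i` vertices. -/
def starVerts (a : ℕ →₀ ℕ) : Finset (ℕ × ℕ) :=
  insert (0, 0) (a.support.biUnion fun i => (Finset.range (a i)).image fun j => (2 * i + 2, j + 1))

theorem mem_starVerts {a : ℕ →₀ ℕ} {v : ℕ × ℕ} :
    v ∈ starVerts a ↔ v = (0, 0) ∨ ∃ i j, j < a i ∧ v = (2 * i + 2, j + 1) := by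
  simp only [starVerts, Finset.mem_insert, Finset.mem_biUnion, Finsupp.mem_support_iff,
    Finset.mem_image, Finset.mem_range]
  refine or_congr_right (exists_congr fun i => ?_)
  constructor
  · rintro ⟨_, j, hj, rfl⟩
    exact ⟨j, hj, rfl⟩
  · rintro ⟨j, hj, rfl⟩
    exact ⟨by omega, j, hj, rfl⟩

theorem arm_mem_starVerts {a : ℕ →₀ ℕ} {i j : ℕ} :
    (2 * i + 2, j + 1) ∈ starVerts a ↔ j < a i := by
  rw [mem_starVerts]
  constructor
  · rintro (h | ⟨i', j', hj, h⟩)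
    · simp at h
    · simp only [Prod.mk.injEq] at h
      obtain rfl : i = i' := by omega
      omega
  · exact fun h => Or.inr ⟨i, j, h, rfl⟩

theorem center_mem_starVerts (a : ℕ →₀ ℕ) : (0, 0) ∈ starVerts a :=
  mem_starVerts.2 (Or.inl rfl)

theorem bistarG_zero_adj_center_arm {i j : ℕ} :
    (bistarG 0).Adj (0, 0) (2 * i + 2, j + 1) ↔ j = 0 := by
  simp [bistarG, SimpleGraph.fromRel_adj]

theorem bistarG_zero_adj_arm_arm {i j i' j' : ℕ} :
    (bistarG 0).Adj (2 * i + 2, j + 1) (2 * i' + 2, j' + 1) ↔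
      i = i' ∧ (j + 1 = j' ∨ j' + 1 = j) := by
  simp only [bistarG, SimpleGraph.fromRel_adj, ne_eq, Prod.mk.injEq, if_true]
  omega

theorem starVerts_preconnected (a : ℕ →₀ ℕ) :
    ((bistarG 0).induce (starVerts a : Set (ℕ × ℕ))).Preconnected := by
  refine preconnected_of_rank (0, 0) Prod.snd fun x hx => ?_
  rcases mem_starVerts.1 (Finset.mem_coe.1 hx) with rfl | ⟨i, j, hj, rfl⟩
  · exact Or.inl rfl
  · right
    rcases j with _ | j
    · exact ⟨(0, 0), center_mem_starVerts a, (bistarG_zero_adj_center_arm.2 rfl).symm,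
        Nat.succ_pos 0⟩
    · exact ⟨(2 * i + 2, j + 1), arm_mem_starVerts.2 (by omega),
        bistarG_zero_adj_arm_arm.2 (by omega), Nat.lt_succ_self _⟩

/-- `b` is obtained from `a` by shortening one arm by one or two vertices. -/
def ArmStep (a b : ℕ →₀ ℕ) : Prop :=
  ∃ i d, (d = 1 ∨ d = 2) ∧ a = b + Finsupp.single i d

theorem ArmStep.validMove {a b : ℕ →₀ ℕ} (h : ArmStep a b) :
    ValidMove (bistarG 0) (starVerts a) (starVerts b) := by
  obtain ⟨i, d, hd, rfl⟩ := h
  have hsdiff : ∀ v, v ∈ starVerts (b + Finsupp.single i d) \ starVerts b ↔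
      ∃ j, b i ≤ j ∧ j < b i + d ∧ v = (2 * i + 2, j + 1) := by
    intro v
    rw [Finset.mem_sdiff]
    constructor
    · rintro ⟨hv, hv'⟩
      rcases mem_starVerts.1 hv with rfl | ⟨i', j, hj, rfl⟩
      · exact absurd (center_mem_starVerts b) hv'
      · rw [arm_mem_starVerts] at hv'
        rw [Finsupp.add_apply, Finsupp.single_apply] at hj
        split_ifs at hj with he
        · subst he
          exact ⟨j, by omega, hj, rfl⟩
        · omega
    · rintro ⟨j, hj, hj', rfl⟩
      rw [arm_mem_starVerts, arm_mem_starVerts, Finsupp.add_apply, Finsupp.single_eq_same]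
      omega
  rw [validMove_iff_of_preconnected (starVerts_preconnected _)]
  refine ⟨fun v hv => ?_, ?_, starVerts_preconnected b⟩
  · rcases mem_starVerts.1 hv with rfl | ⟨i', j, hj, rfl⟩
    · exact center_mem_starVerts _
    · rw [arm_mem_starVerts, Finsupp.add_apply]
      omega
  · have hmem : ∀ j < b i + d, (2 * i + 2, j + 1) ∈ starVerts (b + Finsupp.single i d) := by
      intro j hj
      rwa [arm_mem_starVerts, Finsupp.add_apply, Finsupp.single_eq_same]
    rcases hd with rfl | rfl
    · refine Or.inl ⟨(2 * i + 2, b i + 1), hmem _ (by omega), ?_⟩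
      ext v
      rw [hsdiff, Finset.mem_singleton]
      constructor
      · rintro ⟨j, hj, hj', rfl⟩
        rw [show j = b i by omega]
      · exact fun hv => ⟨b i, le_rfl, by omega, hv⟩
    · refine Or.inr ⟨(2 * i + 2, b i + 1), hmem _ (by omega), (2 * i + 2, b i + 1 + 1),
        hmem _ (by omega), bistarG_zero_adj_arm_arm.2 (by omega), ?_⟩
      ext v
      rw [hsdiff, Finset.mem_insert, Finset.mem_singleton]
      constructor
      · rintro ⟨j, hj, hj', rfl⟩
        rcases (by omega : j = b i ∨ j = b i + 1) with rfl | rfl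
        · exact Or.inl rfl
        · exact Or.inr rfl
      · rintro (hv | hv)
        · exact ⟨b i, le_rfl, by omega, hv⟩
        · exact ⟨b i + 1, by omega, by omega, hv⟩

/-- The center of a star with at least three arms cannot be removed. -/
theorem center_mem_of_preconnected {a : ℕ →₀ ℕ} (ha : 3 ≤ a.support.card) {t : Finset (ℕ × ℕ)}
    (hts : t ⊆ starVerts a)
    (hrem : (∃ x ∈ starVerts a, starVerts a \ t = {x}) ∨
      (∃ x ∈ starVerts a, ∃ y ∈ starVerts a, (bistarG 0).Adj x y ∧ starVerts a \ t = {x, y}))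
    (hconn : ((bistarG 0).induce (t : Set (ℕ × ℕ))).Preconnected) : (0, 0) ∈ t := by
  by_contra h0
  have h0' : ((0, 0) : ℕ × ℕ) ∈ starVerts a \ t :=
    Finset.mem_sdiff.2 ⟨center_mem_starVerts a, h0⟩
  obtain ⟨y, hy⟩ : ∃ y, starVerts a \ t ⊆ {(0, 0), y} := by
    rcases hrem with ⟨x, -, he⟩ | ⟨x, -, y, -, -, he⟩
    · rw [he, Finset.mem_singleton] at h0'
      exact ⟨x, by simp [he, h0']⟩
    · rw [he, Finset.mem_insert, Finset.mem_singleton] at h0'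
      rcases h0' with rfl | rfl
      · exact ⟨y, by rw [he]⟩
      · exact ⟨x, by rw [he, Finset.pair_comm]⟩
  have hfirst : ∀ i ∈ a.support, 2 * i + 2 ≠ y.1 → (2 * i + 2, 0 + 1) ∈ t := by
    intro i hi hne
    by_contra hit
    have hmem : (2 * i + 2, 0 + 1) ∈ starVerts a \ t :=
      Finset.mem_sdiff.2 ⟨arm_mem_starVerts.2 (Nat.pos_of_ne_zero (Finsupp.mem_support_iff.1 hi)),
        hit⟩
    have := hy hmem
    rw [Finset.mem_insert, Finset.mem_singleton] at this
    rcases this with he | he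
    · simp at he
    · exact hne (by rw [← he])
  have hcard : 1 < (a.support.erase ((y.1 - 2) / 2)).card := by
    have := Finset.pred_card_le_card_erase (s := a.support) (a := (y.1 - 2) / 2)
    omega
  obtain ⟨i₁, hi₁, i₂, hi₂, hne⟩ := Finset.one_lt_card.1 hcard
  rw [Finset.mem_erase] at hi₁ hi₂
  have h₁ := hfirst i₁ hi₁.2 (by omega)
  have h₂ := hfirst i₂ hi₂.2 (by omega)
  have := mem_of_preconnected_of_closed (A := {v : ℕ × ℕ | v.1 = 2 * i₁ + 2}) hconn
    (Finset.mem_coe.2 h₁) rfl (Finset.mem_coe.2 h₂) (by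
      rintro u hu huA v hv huv
      rcases mem_starVerts.1 (hts hu) with rfl | ⟨i, j, -, rfl⟩
      · exact absurd hu h0
      rcases mem_starVerts.1 (hts hv) with rfl | ⟨i', j', -, rfl⟩
      · exact absurd hv h0
      rw [bistarG_zero_adj_arm_arm] at huv
      simp only [Set.mem_ofPred_eq] at huA ⊢
      omega)
  simp only [Set.mem_ofPred_eq] at this
  omega

/-- The legal moves on a star with at least three arms shorten an arm. -/
theorem exists_armStep_of_validMove {a : ℕ →₀ ℕ} (ha : 3 ≤ a.support.card) {t : Finset (ℕ × ℕ)}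
    (ht : ValidMove (bistarG 0) (starVerts a) t) : ∃ b, ArmStep a b ∧ t = starVerts b := by
  rw [validMove_iff_of_preconnected (starVerts_preconnected a)] at ht
  obtain ⟨hts, hrem, hconn⟩ := ht
  have h0 := center_mem_of_preconnected ha hts hrem hconn
  obtain ⟨i, j, d, hd, hjd, hk⟩ : ∃ i j d, (d = 1 ∨ d = 2) ∧ j + d ≤ a i ∧
      ∀ i' k, k < a i' → ((2 * i' + 2, k + 1) ∈ t ↔ ¬ (i' = i ∧ j ≤ k ∧ k < j + d)) := by
    have hnot : ∀ i' k, k < a i' →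
        ((2 * i' + 2, k + 1) ∈ t ↔ ¬ (2 * i' + 2, k + 1) ∈ starVerts a \ t) := by
      intro i' k hk
      simp [arm_mem_starVerts.2 hk]
    have hcenter : ((0, 0) : ℕ × ℕ) ∉ starVerts a \ t := fun h => (Finset.mem_sdiff.1 h).2 h0
    rcases hrem with ⟨x, hx, he⟩ | ⟨x, hx, y, hy, hxy, he⟩
    · rcases mem_starVerts.1 hx with rfl | ⟨i, j, hj, rfl⟩
      · simp [he] at hcenter
      refine ⟨i, j, 1, Or.inl rfl, hj, fun i' k hk => ?_⟩
      rw [hnot i' k hk, he, Finset.mem_singleton, Prod.mk.injEq]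
      omega
    · rcases mem_starVerts.1 hx with rfl | ⟨i, j, hj, rfl⟩
      · simp [he] at hcenter
      rcases mem_starVerts.1 hy with rfl | ⟨i₂, j₂, hj₂, rfl⟩
      · simp [he] at hcenter
      obtain ⟨rfl, hjj⟩ := bistarG_zero_adj_arm_arm.1 hxy
      refine ⟨i, min j j₂, 2, Or.inr rfl, by omega, fun i' k hk => ?_⟩
      rw [hnot i' k hk, he, Finset.mem_insert, Finset.mem_singleton, Prod.mk.injEq, Prod.mk.injEq]
      omega
  have hend : j + d = a i := by
    by_contra hcon
    have hlast : (2 * i + 2, j + d + 1) ∈ t := (hk i (j + d) (by omega)).2 (by omega)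
    have := mem_of_preconnected_of_closed (A := {v : ℕ × ℕ | v.1 = 2 * i + 2 ∧ j + d < v.2}) hconn
      (Finset.mem_coe.2 hlast) ⟨rfl, Nat.lt_succ_self _⟩ (Finset.mem_coe.2 h0) (by
        rintro u hu ⟨hu₁, hu₂⟩ v hv huv
        rcases mem_starVerts.1 (hts hu) with rfl | ⟨i', k, hki, rfl⟩
        · omega
        dsimp only at hu₁ hu₂
        rcases mem_starVerts.1 (hts hv) with rfl | ⟨i₂, k₂, hki₂, rfl⟩
        · have := bistarG_zero_adj_center_arm.1 huv.symm
          omega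
        · rw [bistarG_zero_adj_arm_arm] at huv
          have := (hk i₂ k₂ hki₂).1 hv
          simp only [Set.mem_ofPred_eq]
          omega)
    simp at this
  have hab : a = (a - Finsupp.single i d) + Finsupp.single i d := by
    ext i'
    simp only [Finsupp.add_apply, Finsupp.tsub_apply, Finsupp.single_apply]
    split_ifs with he
    · subst he
      omega
    · omega
  refine ⟨a - Finsupp.single i d, ⟨i, d, hd, hab⟩, ?_⟩
  ext v
  rw [mem_starVerts]
  constructor
  · intro hv
    refine (mem_starVerts.1 (hts hv)).imp_right ?_
    rintro ⟨i', k, hki, rfl⟩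
    refine ⟨i', k, ?_, rfl⟩
    have := (hk i' k hki).1 hv
    rw [Finsupp.tsub_apply, Finsupp.single_apply]
    split_ifs with he
    · subst he
      omega
    · omega
  · rintro (rfl | ⟨i', k, hki, rfl⟩)
    · exact h0
    · rw [Finsupp.tsub_apply, Finsupp.single_apply] at hki
      split_ifs at hki with he
      · subst he
        exact (hk i k (by omega)).2 (by omega)
      · exact (hk i' k (by omega)).2 (by omega)

theorem exists_pair_of_card_support_le_two {a : ℕ →₀ ℕ} (ha : a.support.card ≤ 2) :
    ∃ i₁ i₂, i₁ ≠ i₂ ∧ ∀ i, i ≠ i₁ → i ≠ i₂ → a i = 0 := by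
  obtain ⟨u, hu, hcard⟩ := Infinite.exists_superset_card_eq a.support 2 ha
  obtain ⟨i₁, i₂, hne, rfl⟩ := Finset.card_eq_two.1 hcard
  refine ⟨i₁, i₂, hne, fun i h₁ h₂ => ?_⟩
  by_contra h
  have := hu (Finsupp.mem_support_iff.2 h)
  simp [h₁, h₂] at this

theorem degree_eq_add {a : ℕ →₀ ℕ} {i₁ i₂ : ℕ} (hne : i₁ ≠ i₂)
    (h : ∀ i, i ≠ i₁ → i ≠ i₂ → a i = 0) : a.degree = a i₁ + a i₂ := by
  rw [Finsupp.degree_apply, ← Finset.sum_pair (f := a) hne]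
  refine Finset.sum_subset (fun i hi => ?_) (fun i _ hi => by simpa using hi)
  by_contra hi'
  simp only [Finset.mem_insert, Finset.mem_singleton, not_or] at hi'
  exact Finsupp.mem_support_iff.1 hi (h i hi'.1 hi'.2)

/-- A star with at most two arms is a path. -/
theorem grundy_starVerts_of_card_le_two {a : ℕ →₀ ℕ} (ha : a.support.card ≤ 2) :
    grundy (bistarG 0) (starVerts a) = (a.degree + 1) % 3 := by
  obtain ⟨i₁, i₂, hne, h⟩ := exists_pair_of_card_support_le_two ha
  rw [degree_eq_add hne h]
  let f : ℕ → ℕ × ℕ := fun k =>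
    if k < a i₁ then (2 * i₁ + 2, (a i₁ - 1 - k) + 1)
    else if k = a i₁ then (0, 0) else (2 * i₂ + 2, (k - 1 - a i₁) + 1)
  have hf : IsInducedPath (bistarG 0) f (a i₁ + a i₂ + 1) := by
    intro i hi j hj
    simp only [f]
    split_ifs <;>
      first
      | rw [bistarG_zero_adj_arm_arm, Prod.mk.injEq]; omega
      | rw [bistarG_zero_adj_center_arm, Prod.mk.injEq]; omega
      | rw [SimpleGraph.adj_comm, bistarG_zero_adj_center_arm, Prod.mk.injEq]; omega
      | simp only [SimpleGraph.irrefl, false_iff]; omega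
  rw [← hf.grundy_eq]
  congr 1
  ext v
  rw [mem_starVerts, Finset.mem_image]
  constructor
  · rintro (rfl | ⟨i, j, hj, rfl⟩)
    · exact ⟨a i₁, Finset.mem_range.2 (by omega), by simp [f]⟩
    · by_cases h₁ : i = i₁
      · subst h₁
        refine ⟨a i - 1 - j, Finset.mem_range.2 (by omega), ?_⟩
        simp only [f]
        rw [if_pos (by omega), Prod.mk.injEq]
        omega
      · by_cases h₂ : i = i₂
        · subst h₂
          refine ⟨a i₁ + 1 + j, Finset.mem_range.2 (by omega), ?_⟩
          simp only [f]
          rw [if_neg (by omega), if_neg (by omega), Prod.mk.injEq]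
          omega
        · have := h i h₁ h₂
          omega
  · rintro ⟨k, hk, rfl⟩
    have hk := Finset.mem_range.1 hk
    simp only [f]
    split_ifs with h₁ h₂
    · exact Or.inr ⟨i₁, _, by omega, rfl⟩
    · exact Or.inl rfl
    · exact Or.inr ⟨i₂, _, by omega, rfl⟩

/-- All arm lengths reduced modulo three. -/
noncomputable def modThree (a : ℕ →₀ ℕ) : ℕ →₀ ℕ := a.mapRange (· % 3) rfl

theorem modThree_apply (a : ℕ →₀ ℕ) (i : ℕ) : modThree a i = a i % 3 := rfl

theorem support_modThree_subset (a : ℕ →₀ ℕ) : (modThree a).support ⊆ a.support :=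
  Finsupp.support_mapRange

theorem degree_modThree_mod (a : ℕ →₀ ℕ) : (modThree a).degree % 3 = a.degree % 3 := by
  rw [Finsupp.degree_apply, Finsupp.degree_apply, Finset.sum_nat_mod a.support,
    Finset.sum_subset (support_modThree_subset a) (fun i _ hi => by simpa using hi)]
  rfl

theorem ArmStep.degree_lt {a b : ℕ →₀ ℕ} (h : ArmStep a b) : b.degree < a.degree := by
  obtain ⟨i, d, hd, rfl⟩ := h
  rw [map_add, Finsupp.degree_single]
  omega

/-- Shortening one arm changes the residues by shortening or by lengthening one of them. -/
theorem ArmStep.modThree {a b : ℕ →₀ ℕ} (h : ArmStep a b) :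
    ArmStep (modThree a) (modThree b) ∨ ArmStep (modThree b) (modThree a) := by
  obtain ⟨i, d, hd, rfl⟩ := h
  rcases (by omega : b i % 3 < (b i + d) % 3 ∨ (b i + d) % 3 < b i % 3) with hlt | hlt
  · refine Or.inl ⟨i, (b i + d) % 3 - b i % 3, by omega, ?_⟩
    ext k
    simp only [Finsupp.add_apply, modThree_apply, Finsupp.single_apply]
    split_ifs with he
    · subst he
      omega
    · omega
  · refine Or.inr ⟨i, b i % 3 - (b i + d) % 3, by omega, ?_⟩
    ext k
    simp only [Finsupp.add_apply, modThree_apply, Finsupp.single_apply]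
    split_ifs with he
    · subst he
      omega
    · omega

theorem ArmStep.exists_lift {a c : ℕ →₀ ℕ} (h : ArmStep (_root_.modThree a) c) :
    ∃ b, ArmStep a b ∧ _root_.modThree b = c := by
  obtain ⟨i, d, hd, he⟩ := h
  have hc : ∀ k, a k % 3 = c k + Finsupp.single i d k := fun k => by
    rw [← Finsupp.add_apply, ← he, modThree_apply]
  refine ⟨a - Finsupp.single i d, ⟨i, d, hd, ?_⟩, ?_⟩ <;> ext k <;> have := hc k <;>
    simp only [Finsupp.add_apply, Finsupp.tsub_apply, modThree_apply] <;>
    rw [Finsupp.single_apply] at * <;> split_ifs at * <;> omega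

theorem armStep_sub_single {a : ℕ →₀ ℕ} {i d : ℕ} (hd : d = 1 ∨ d = 2) (hi : d ≤ a i) :
    ArmStep a (a - Finsupp.single i d) := by
  refine ⟨i, d, hd, ?_⟩
  ext k
  simp only [Finsupp.add_apply, Finsupp.tsub_apply, Finsupp.single_apply]
  split_ifs with he
  · subst he
    omega
  · omega

theorem support_modThree_sub_single_subset (a : ℕ →₀ ℕ) (i d : ℕ) :
    (modThree (a - Finsupp.single i d)).support ⊆ insert i (modThree a).support := by
  intro k hk
  rw [Finset.mem_insert]
  by_contra! hcon
  rw [Finsupp.mem_support_iff, modThree_apply, Finsupp.tsub_apply,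
    Finsupp.single_eq_of_ne hcon.1] at hk
  exact hcon.2 (Finsupp.mem_support_iff.2 (by simpa [modThree_apply] using hk))

/-- If at most two arms of a star with at least three arms survive the reduction, then every
smaller value of the reduced path is reached by shortening an arm. -/
theorem exists_arm_of_card_le_two {a : ℕ →₀ ℕ} (ha : 3 ≤ a.support.card)
    (ha' : (modThree a).support.card ≤ 2) {d : ℕ}
    (hle : d ≤ ((modThree a).degree + 1) % 3) :
    ∃ i, d ≤ a i ∧ (modThree (a - Finsupp.single i d)).support.card ≤ 2 := by
  rcases Nat.lt_or_ge (modThree a).support.card 2 with hlt | hge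
  · have hss : ¬ a.support ⊆ (modThree a).support := fun hs => by
      have := Finset.card_le_card hs
      omega
    obtain ⟨i, hi, hi'⟩ := Finset.not_subset.1 hss
    rw [Finsupp.mem_support_iff] at hi
    rw [Finsupp.notMem_support_iff, modThree_apply] at hi'
    refine ⟨i, by omega, (Finset.card_le_card (support_modThree_sub_single_subset a i d)).trans ?_⟩
    have := Finset.card_insert_le i (modThree a).support
    omega
  · obtain ⟨i₁, i₂, hne, hsupp⟩ := Finset.card_eq_two.1 (le_antisymm ha' hge)
    have hdeg : (modThree a).degree = a i₁ % 3 + a i₂ % 3 := by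
      refine degree_eq_add hne fun i h₁ h₂ => ?_
      rw [← Finsupp.notMem_support_iff, hsupp]
      simp [h₁, h₂]
    have hi₁ : i₁ ∈ (modThree a).support := by simp [hsupp]
    have hi₂ : i₂ ∈ (modThree a).support := by simp [hsupp]
    have h₁ := Finsupp.mem_support_iff.1 hi₁
    have h₂ := Finsupp.mem_support_iff.1 hi₂
    rw [modThree_apply] at h₁ h₂
    have hcard : ∀ i ∈ (modThree a).support,
        (modThree (a - Finsupp.single i d)).support.card ≤ 2 := fun i hi => by
      refine (Finset.card_le_card (support_modThree_sub_single_subset a i d)).trans ?_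
      rwa [Finset.insert_eq_of_mem hi]
    rcases (by omega : d ≤ a i₁ ∨ d ≤ a i₂) with h | h
    · exact ⟨i₁, h, hcard i₁ hi₁⟩
    · exact ⟨i₂, h, hcard i₂ hi₂⟩

theorem grundy_starVerts_modThree (a : ℕ →₀ ℕ) :
    grundy (bistarG 0) (starVerts a) = grundy (bistarG 0) (starVerts (modThree a)) := by
  induction hn : a.degree using Nat.strong_induction_on generalizing a with
  | _ n ih =>
    subst hn
    have hstep : ∀ b, ArmStep a b → grundy (bistarG 0) (starVerts b) =
        grundy (bistarG 0) (starVerts (modThree b)) := fun b hb => ih _ hb.degree_lt b rfl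
    rcases Nat.lt_or_ge a.support.card 3 with hlt | ha
    · have := Finset.card_le_card (support_modThree_subset a)
      rw [grundy_starVerts_of_card_le_two (by omega), grundy_starVerts_of_card_le_two (by omega)]
      have := degree_modThree_mod a
      omega
    refine grundy_eq_of_options (fun t ht => ?_) (fun m hm => ?_)
    · obtain ⟨b, hb, rfl⟩ := exists_armStep_of_validMove ha ht
      rw [hstep b hb]
      exact hb.modThree.elim (fun h => h.validMove.grundy_ne) fun h => h.validMove.grundy_ne.symm
    · rcases Nat.lt_or_ge (modThree a).support.card 3 with hlt | ha'
      · rw [grundy_starVerts_of_card_le_two (by omega)] at hm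
        have hd : ((modThree a).degree + 1) % 3 - m = 1 ∨
            ((modThree a).degree + 1) % 3 - m = 2 := by omega
        obtain ⟨i, hi, hcard⟩ := exists_arm_of_card_le_two ha (by omega) (Nat.sub_le _ _)
        have hb := armStep_sub_single hd hi
        refine ⟨_, hb.validMove, ?_⟩
        rw [hstep _ hb, grundy_starVerts_of_card_le_two hcard]
        have h₁ := degree_modThree_mod a
        have h₂ := degree_modThree_mod
          (a - Finsupp.single i (((modThree a).degree + 1) % 3 - m))
        have h₃ : a.degree = (a - Finsupp.single i (((modThree a).degree + 1) % 3 - m)).degree +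
            (((modThree a).degree + 1) % 3 - m) := by
          rw [← Finsupp.degree_single i (((modThree a).degree + 1) % 3 - m), ← map_add,
            Finsupp.degree_single, tsub_add_cancel_of_le (Finsupp.single_le_iff.2 hi)]
        omega
      · obtain ⟨t, ht, rfl⟩ := exists_validMove_of_lt_grundy hm
        obtain ⟨c, hc, rfl⟩ := exists_armStep_of_validMove ha' ht
        obtain ⟨b, hb, rfl⟩ := hc.exists_lift
        exact ⟨_, hb.validMove, hstep b hb⟩

theorem starGrundy_eq_grundy_starVerts (L : List ℕ) {a : ℕ →₀ ℕ} (ha : ∀ i, a i = L.getD i 0) :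
    starGrundy L = grundy (bistarG 0) (starVerts a) := by
  unfold starGrundy bistarGrundy bistarGrundyO
  congr 1
  ext v
  simp only [mem_starVerts, bistarVerts, armVerts, Finset.mem_union, Finset.mem_insert,
    Finset.mem_biUnion, Finset.mem_image, Finset.mem_range, List.length_nil, Nat.not_lt_zero,
    false_and, exists_false, or_false, ha]
  refine or_congr_right (exists_congr fun i => ?_)
  constructor
  · rintro ⟨_, j, hj, rfl⟩
    exact ⟨j, hj, rfl⟩
  · rintro ⟨j, hj, rfl⟩
    refine ⟨?_, j, hj, rfl⟩
    by_contra hi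
    rw [List.getD_eq_default _ _ (not_lt.1 hi)] at hj
    omega

/-- The arms of a subdivided star can be reduced modulo 3 without changing the Grundy
value of the 0.33 game (arms of length `≡ 0 (mod 3)` are omitted: an arm of length `0`
contributes no vertices). -/
theorem grundy_star_mod_three (L : List ℕ) (hL : armsPos L) :
    starGrundy L = starGrundy (L.map (· % 3)) := by
  have h₁ : ∀ i, L.toFinsupp i = L.getD i 0 := fun i => L.toFinsupp_apply i
  rw [starGrundy_eq_grundy_starVerts L h₁, grundy_starVerts_modThree]
  refine (starGrundy_eq_grundy_starVerts _ fun i => ?_).symm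
  rw [modThree_apply, h₁]
  exact (List.getD_map (n := i) (l := L) (d := 0) (· % 3)).symm
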